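/- arXiv:1107.5340 — 3 statements merged into one kernel-verified Lean document; each statement's English description precedes it below -/
import Mathlib

section
/- For all i, j with 1 ≤ i, j ≤ m+1, the matrices B_i and B_j are invertible and A_j · B_j⁻¹ = A_i · B_i⁻¹; that is, the product A_i · B_i⁻¹ does not depend on the index i. -/
open Matrix

noncomputable section

/-- Lower triangular Toeplitz m×m matrix: entry (i,j) equals `a (i-j)` (0-based),
i.e. `a_{i-j+1}` in the 1-based notation of the paper, for j ≤ i, and 0 otherwise. -/
def lowT (m : ℕ) (a : Fin (m + 1) → ℝ) : Matrix (Fin m) (Fin m) ℝ :=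
  fun i j =>
    if h : (j : ℕ) ≤ (i : ℕ) then a ⟨(i : ℕ) - (j : ℕ), by have := i.2; omega⟩ else 0

/-- Upper triangular Toeplitz m×m matrix: entry (i,j) equals `a (m + i - j)` (0-based),
i.e. `a_{m+1+i-j}` in the 1-based notation of the paper, for i ≤ j, and 0 otherwise. -/
def upT (m : ℕ) (a : Fin (m + 1) → ℝ) : Matrix (Fin m) (Fin m) ℝ :=
  fun i j =>
    if h : (i : ℕ) ≤ (j : ℕ) then a ⟨m + (i : ℕ) - (j : ℕ), by have := j.2; omega⟩ else 0

/-- The 2m×2m Sylvester matrix S = [[D_L, N_L],[D_U, N_U]]. -/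
def sylv (m : ℕ) (d n : Fin (m + 1) → ℝ) : Matrix (Fin (m + m)) (Fin (m + m)) ℝ :=
  (fromBlocks (lowT m d) (lowT m n) (upT m d) (upT m n)).submatrix
    finSumFinEquiv.symm finSumFinEquiv.symm

/-- The 2m×2m lower triangular matrix D = [[D_L, 0],[D_U, D_L]]. -/
def dMat (m : ℕ) (d : Fin (m + 1) → ℝ) : Matrix (Fin (m + m)) (Fin (m + m)) ℝ :=
  (fromBlocks (lowT m d) (0 : Matrix (Fin m) (Fin m) ℝ) (upT m d) (lowT m d)).submatrix
    finSumFinEquiv.symm finSumFinEquiv.symm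

/-- The m×2m matrix formed by the last m rows of a 2m×2m matrix. -/
def lastRows (m : ℕ) (M : Matrix (Fin (m + m)) (Fin (m + m)) ℝ) :
    Matrix (Fin m) (Fin (m + m)) ℝ :=
  fun i j => M ⟨m + (i : ℕ), by have := i.2; omega⟩ j

/-- The m×m submatrix of an m×2m matrix consisting of the m consecutive columns
starting from column i (0-based; column i+1 in the 1-based notation of the paper). -/
def subCols (m : ℕ) (M : Matrix (Fin m) (Fin (m + m)) ℝ) (i : Fin (m + 1)) :
    Matrix (Fin m) (Fin m) ℝ :=
  fun r c => M r ⟨(i : ℕ) + (c : ℕ), by have := i.2; have := c.2; omega⟩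

/-- The kernel T = ( -D_U·D_L⁻¹ | I_m | -D_L·D_U⁻¹ ), an m×3m matrix. -/
def kerT (m : ℕ) (d : Fin (m + 1) → ℝ) : Matrix (Fin m) (Fin (m + m + m)) ℝ :=
  (fromCols
      (fromCols (-(upT m d * (lowT m d)⁻¹)) (1 : Matrix (Fin m) (Fin m) ℝ))
      (-(lowT m d * (upT m d)⁻¹))).submatrix id
    (((Equiv.sumCongr finSumFinEquiv (Equiv.refl (Fin m))).trans finSumFinEquiv).symm)

/-- T_i : the m×2m submatrix of T consisting of the 2m consecutive columns
starting from column i (0-based). -/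
def tSub (m : ℕ) (d : Fin (m + 1) → ℝ) (i : Fin (m + 1)) :
    Matrix (Fin m) (Fin (m + m)) ℝ :=
  fun r c => kerT m d r ⟨(i : ℕ) + (c : ℕ), by have := i.2; have := c.2; omega⟩

/-- T_{i,j} : the m×m submatrix of T_i consisting of the m consecutive columns
starting from column j (0-based). -/
def tSub2 (m : ℕ) (d : Fin (m + 1) → ℝ) (i j : Fin (m + 1)) :
    Matrix (Fin m) (Fin m) ℝ :=
  fun r c =>
    kerT m d r ⟨(i : ℕ) + (j : ℕ) + (c : ℕ), by have := i.2; have := j.2; have := c.2; omega⟩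

/-- The 2m×m block column matrix [D_L; D_U]. -/
def dlMat (m : ℕ) (d : Fin (m + 1) → ℝ) : Matrix (Fin (m + m)) (Fin m) ℝ :=
  (fromRows (lowT m d) (upT m d)).submatrix finSumFinEquiv.symm id

/-- The 2m×m block column matrix [0; D_L]. -/
def drMat (m : ℕ) (d : Fin (m + 1) → ℝ) : Matrix (Fin (m + m)) (Fin m) ℝ :=
  (fromRows (0 : Matrix (Fin m) (Fin m) ℝ) (lowT m d)).submatrix finSumFinEquiv.symm id

/-- The 2m×m block column matrix [N_L; N_U]. -/
def nMat (m : ℕ) (n : Fin (m + 1) → ℝ) : Matrix (Fin (m + m)) (Fin m) ℝ :=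
  (fromRows (lowT m n) (upT m n)).submatrix finSumFinEquiv.symm id

/-- The 3m×2m block matrix [[X_L, 0],[X_U, X_L],[0, X_U]] built from the
lower/upper triangular Toeplitz matrices of a. -/
def kMat (m : ℕ) (a : Fin (m + 1) → ℝ) : Matrix (Fin (m + m + m)) (Fin (m + m)) ℝ :=
  (fromRows
      (fromRows (fromCols (lowT m a) (0 : Matrix (Fin m) (Fin m) ℝ))
        (fromCols (upT m a) (lowT m a)))
      (fromCols (0 : Matrix (Fin m) (Fin m) ℝ) (upT m a))).submatrix
    (((Equiv.sumCongr finSumFinEquiv (Equiv.refl (Fin m))).trans finSumFinEquiv).symm)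
    finSumFinEquiv.symm

/-- Index reversal i ↦ m - i on 0-based indices, corresponding to the 1-based
index map i ↦ m - i + 2 of the paper. -/
def revIdx (m : ℕ) (i : Fin (m + 1)) : Fin (m + 1) := ⟨m - (i : ℕ), by omega⟩

theorem dlMat_apply (m : ℕ) (d : Fin (m + 1) → ℝ) (r : Fin (m + m)) (j : Fin m) :
    dlMat m d r j =
      if h : (j : ℕ) ≤ r ∧ (r : ℕ) ≤ j + m then d ⟨r - j, by omega⟩ else 0 := by
  have hj := j.2
  refine Fin.addCases (fun i => ?_) (fun i => ?_) r
  · have hi := i.2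
    simp only [dlMat, submatrix_apply, finSumFinEquiv_symm_apply_castAdd, fromRows_apply_inl,
      lowT, id, Fin.val_castAdd]
    split_ifs <;> first | rfl | omega
  · have hi := i.2
    simp only [dlMat, submatrix_apply, finSumFinEquiv_symm_apply_natAdd, fromRows_apply_inr,
      upT, id, Fin.val_natAdd]
    split_ifs <;> first | rfl | omega

theorem sylv_eq_fromCols (m : ℕ) (d n : Fin (m + 1) → ℝ) :
    sylv m d n = (fromCols (dlMat m d) (nMat m n)).submatrix id finSumFinEquiv.symm := by
  ext r c
  refine Fin.addCases (fun i => ?_) (fun i => ?_) r <;>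
    refine Fin.addCases (fun j => ?_) (fun j => ?_) c <;>
    simp [-Fin.natAdd_eq_addNat, sylv, dlMat, nMat]

theorem dMat_eq_fromCols (m : ℕ) (d : Fin (m + 1) → ℝ) :
    dMat m d = (fromCols (dlMat m d) (drMat m d)).submatrix id finSumFinEquiv.symm := by
  ext r c
  refine Fin.addCases (fun i => ?_) (fun i => ?_) r <;>
    refine Fin.addCases (fun j => ?_) (fun j => ?_) c <;>
    simp [-Fin.natAdd_eq_addNat, dMat, dlMat, drMat]

section FromCols

variable {m : ℕ} {X Y : Matrix (Fin (m + m)) (Fin m) ℝ} {M : Matrix (Fin (m + m)) (Fin (m + m)) ℝ}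

theorem lastRows_inv_mul_left (hM : M = (fromCols X Y).submatrix id finSumFinEquiv.symm)
    (hu : IsUnit M) : lastRows m M⁻¹ * X = 0 := by
  have h := nonsing_inv_mul M ((isUnit_iff_isUnit_det M).1 hu)
  ext r c
  have e := congrFun (congrFun h (Fin.natAdd m r)) (Fin.castAdd m c)
  have hne : Fin.natAdd m r ≠ Fin.castAdd m c := by
    have := c.2
    simp only [ne_eq, Fin.ext_iff, Fin.val_natAdd, Fin.val_castAdd]
    omega
  rw [one_apply_ne hne, mul_apply] at e
  rw [mul_apply, Matrix.zero_apply, ← e]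
  refine Finset.sum_congr rfl fun k _ => ?_
  conv_rhs => rw [show M k (Fin.castAdd m c) = X k c by simp [hM]]
  rfl

theorem lastRows_inv_mul_right (hM : M = (fromCols X Y).submatrix id finSumFinEquiv.symm)
    (hu : IsUnit M) : lastRows m M⁻¹ * Y = 1 := by
  have h := nonsing_inv_mul M ((isUnit_iff_isUnit_det M).1 hu)
  ext r c
  have e := congrFun (congrFun h (Fin.natAdd m r)) (Fin.natAdd m c)
  have h1 : (1 : Matrix (Fin (m + m)) (Fin (m + m)) ℝ) (Fin.natAdd m r) (Fin.natAdd m c) =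
      (1 : Matrix (Fin m) (Fin m) ℝ) r c := by
    simp [one_apply]
  rw [h1, mul_apply] at e
  rw [mul_apply, ← e]
  refine Finset.sum_congr rfl fun k _ => ?_
  conv_rhs => rw [show M k (Fin.natAdd m c) = Y k c by simp [-Fin.natAdd_eq_addNat, hM]]
  rfl

/-- A matrix annihilating the left block of columns `X` of an invertible matrix is a left multiple
of the last rows of its inverse. -/
theorem eq_mul_lastRows_inv (hM : M = (fromCols X Y).submatrix id finSumFinEquiv.symm)
    (hu : IsUnit M) {Z : Matrix (Fin m) (Fin (m + m)) ℝ} (hZ : Z * X = 0) :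
    Z = Z * Y * lastRows m M⁻¹ := by
  have h := mul_nonsing_inv M ((isUnit_iff_isUnit_det M).1 hu)
  have hZM : Z = Z * M * M⁻¹ := by rw [Matrix.mul_assoc, h, Matrix.mul_one]
  have hl (r : Fin m) (k : Fin m) : (Z * M) r (Fin.castAdd m k) = 0 := by
    rw [← Matrix.zero_apply (α := ℝ) r k, ← hZ]
    simp [-Fin.natAdd_eq_addNat, mul_apply, hM]
  have hr (r : Fin m) (k : Fin m) : (Z * M) r (Fin.natAdd m k) = (Z * Y) r k := by
    simp [-Fin.natAdd_eq_addNat, mul_apply, hM]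
  ext r c
  conv_lhs => rw [hZM, mul_apply, Fin.sum_univ_add]
  rw [mul_apply]
  simp only [hl, hr, zero_mul, Finset.sum_const_zero, zero_add]
  rfl

end FromCols

/-- A vector in the left kernel of `dlMat` that vanishes on `m` consecutive indices is zero. -/
theorem eq_zero_of_vecMul_dlMat_eq_zero {m : ℕ} {d : Fin (m + 1) → ℝ} (hd : ∀ k, d k ≠ 0)
    {x : Fin (m + m) → ℝ} (hx : x ᵥ* dlMat m d = 0) (i : Fin (m + 1))
    (hw : ∀ s : Fin (m + m), (i : ℕ) ≤ s → (s : ℕ) < i + m → x s = 0) : x = 0 := by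
  have hi := i.2
  have pivot (s : Fin (m + m)) (j : Fin m) (hs : (j : ℕ) ≤ s ∧ (s : ℕ) ≤ j + m)
      (h : ∀ t : Fin (m + m), t ≠ s → (j : ℕ) ≤ t → (t : ℕ) ≤ j + m → x t = 0) : x s = 0 := by
    have e := congrFun hx j
    simp only [vecMul, dotProduct, Pi.zero_apply] at e
    rw [Fintype.sum_eq_single s, dlMat_apply, dif_pos hs] at e
    · exact (mul_eq_zero.1 e).resolve_right (hd _)
    · intro t ht
      rw [dlMat_apply]
      split_ifs with hc
      · rw [h t ht hc.1 hc.2, zero_mul]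
      · exact mul_zero _
  have low (k : ℕ) : ∀ s : Fin (m + m), (s : ℕ) + k + 1 = i → x s = 0 := by
    induction k using Nat.strong_induction_on with
    | _ k ih =>
      intro s hs
      refine pivot s ⟨s, by omega⟩ ⟨le_rfl, by simp⟩ fun t ht h1 h2 => ?_
      have hne : (t : ℕ) ≠ s := fun h => ht (Fin.ext h)
      simp only at h1 h2
      by_cases hti : (t : ℕ) < i
      · exact ih (i - t - 1) (by omega) t (by omega)
      · exact hw t (by omega) (by omega)
  have high (k : ℕ) : ∀ s : Fin (m + m), (s : ℕ) = i + m + k → x s = 0 := by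
    induction k using Nat.strong_induction_on with
    | _ k ih =>
      intro s hs
      have hs2 := s.2
      refine pivot s ⟨s - m, by omega⟩ ⟨by simp, by simp only; omega⟩ fun t ht h1 h2 => ?_
      have hne : (t : ℕ) ≠ s := fun h => ht (Fin.ext h)
      simp only at h1 h2
      by_cases hti : (t : ℕ) < i + m
      · exact hw t (by omega) hti
      · exact ih (t - i - m) (by omega) t (by omega)
  funext s
  by_cases h1 : (s : ℕ) < i
  · exact low (i - s - 1) s (by omega)
  by_cases h2 : (s : ℕ) < i + m
  · exact hw s (by omega) h2
  · exact high (s - i - m) s (by omega)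

theorem isUnit_subCols {m : ℕ} {d : Fin (m + 1) → ℝ} (hd : ∀ k, d k ≠ 0)
    {Z : Matrix (Fin m) (Fin (m + m)) ℝ} {Y : Matrix (Fin (m + m)) (Fin m) ℝ}
    (hZ : Z * dlMat m d = 0) (hY : Z * Y = 1) (i : Fin (m + 1)) : IsUnit (subCols m Z i) := by
  rw [← vecMul_injective_iff_isUnit]
  refine (injective_iff_map_eq_zero (subCols m Z i).vecMulLinear).2 fun v hv => ?_
  have hx : v ᵥ* Z = 0 := by
    refine eq_zero_of_vecMul_dlMat_eq_zero hd (by rw [vecMul_vecMul, hZ, vecMul_zero]) i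
      fun s h1 h2 => ?_
    have e := congrFun hv ⟨s - i, by omega⟩
    have hs : (⟨(i : ℕ) + (s - i), by omega⟩ : Fin (m + m)) = s := Fin.ext (by simp only; omega)
    simpa [vecMul, dotProduct, subCols, hs] using e
  rw [← vecMul_one v, ← hY, ← vecMul_vecMul, hx, zero_vecMul]

theorem mul_inv_invariant (m : ℕ) (hm : 1 ≤ m) (d n : Fin (m + 1) → ℝ) (hd : ∀ k, d k ≠ 0) (hn : ∀ k, n k ≠ 0)
    (hS : IsUnit (sylv m d n)) (hD : IsUnit (dMat m d)) :
    ∀ i j : Fin (m + 1),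
      IsUnit (subCols m (lastRows m (sylv m d n)⁻¹) i) ∧ IsUnit (subCols m (lastRows m (sylv m d n)⁻¹) j) ∧
        subCols m (lastRows m (dMat m d)⁻¹) j * (subCols m (lastRows m (sylv m d n)⁻¹) j)⁻¹ =
          subCols m (lastRows m (dMat m d)⁻¹) i * (subCols m (lastRows m (sylv m d n)⁻¹) i)⁻¹ := by
  have hSc := sylv_eq_fromCols m d n
  have hDc := dMat_eq_fromCols m d
  have hu := isUnit_subCols hd (lastRows_inv_mul_left hSc hS) (lastRows_inv_mul_right hSc hS)
  have hA := eq_mul_lastRows_inv hSc hS (lastRows_inv_mul_left hDc hD)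
  have key (i : Fin (m + 1)) :
      subCols m (lastRows m (dMat m d)⁻¹) i * (subCols m (lastRows m (sylv m d n)⁻¹) i)⁻¹ =
        lastRows m (dMat m d)⁻¹ * nMat m n := by
    have hAi : subCols m (lastRows m (dMat m d)⁻¹) i =
        lastRows m (dMat m d)⁻¹ * nMat m n * subCols m (lastRows m (sylv m d n)⁻¹) i :=
      congrArg (fun Z => subCols m Z i) hA
    rw [hAi, mul_nonsing_inv_cancel_right _ _ ((isUnit_iff_isUnit_det _).1 (hu i))]
  exact fun i j => ⟨hu i, hu j, (key j).trans (key i).symm⟩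
end
end

section
/- For all i, j with 1 ≤ i < j ≤ m+1, the matrix B_i is invertible and B_i⁻¹ · B_j = B_j · B_i⁻¹. -/
open Matrix

noncomputable section

/-- Column `c` of the stacked Toeplitz matrices is the coefficient vector `a` shifted down by `c`. -/
theorem sum_mul_toeplitz_column (m : ℕ) (a : Fin (m + 1) → ℝ) (f : Fin (m + m) → ℝ) (c : Fin m) :
    ∑ i, f (Fin.castAdd m i) * lowT m a i c + ∑ i, f (Fin.natAdd m i) * upT m a i c =
      ∑ k : Fin (m + 1), a k * f ⟨k + c, by omega⟩ := by
  have hlow (i : Fin m) : lowT m a i c =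
      ∑ k : Fin (m + 1), if Fin.castAdd m i = ⟨k + c, by omega⟩ then a k else 0 := by
    unfold lowT
    split_ifs with h
    · rw [Finset.sum_eq_single ⟨i - c, by omega⟩]
      · rw [if_pos]; ext; simp; omega
      · intro k _ hk
        rw [if_neg]
        intro e
        apply hk
        have := congrArg Fin.val e
        ext; simp at this ⊢; omega
      · simp
    · symm
      apply Finset.sum_eq_zero
      intro k _
      rw [if_neg]
      intro e
      have := congrArg Fin.val e
      simp at this; omega
  have hup (i : Fin m) : upT m a i c =
      ∑ k : Fin (m + 1), if Fin.natAdd m i = ⟨k + c, by omega⟩ then a k else 0 := by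
    unfold upT
    split_ifs with h
    · rw [Finset.sum_eq_single ⟨m + i - c, by omega⟩]
      · rw [if_pos]; ext; simp; omega
      · intro k _ hk
        rw [if_neg]
        intro e
        apply hk
        have := congrArg Fin.val e
        ext; simp at this ⊢; omega
      · simp
    · symm
      apply Finset.sum_eq_zero
      intro k _
      rw [if_neg]
      intro e
      have := congrArg Fin.val e
      simp at this; omega
  simp_rw [hlow, hup]
  rw [← Fin.sum_univ_add (fun j : Fin (m + m) => f j *
    ∑ k : Fin (m + 1), if j = ⟨k + c, by omega⟩ then a k else 0)]
  simp_rw [Finset.mul_sum]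
  rw [Finset.sum_comm]
  simp [mul_comm]

theorem sum_smul_subCols_lastRows_eq_zero (m : ℕ) (d n : Fin (m + 1) → ℝ)
    (hS : IsUnit (sylv m d n)) :
    ∑ k, d k • subCols m (lastRows m (sylv m d n)⁻¹) k = 0 := by
  have h := nonsing_inv_mul _ ((isUnit_iff_isUnit_det _).1 hS)
  generalize (sylv m d n)⁻¹ = B at h ⊢
  ext r c
  have hrc := congrFun (congrFun h (Fin.natAdd m r)) (Fin.castAdd m c)
  rw [mul_apply, Fin.sum_univ_add] at hrc
  simp only [sylv, submatrix_apply, finSumFinEquiv_symm_apply_castAdd,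
    finSumFinEquiv_symm_apply_natAdd, fromBlocks_apply₁₁, fromBlocks_apply₂₁] at hrc
  rw [sum_mul_toeplitz_column, one_apply_ne (by simp [Fin.ext_iff]; omega)] at hrc
  rw [Matrix.sum_apply]
  exact hrc

theorem sum_smul_subCols_lastRows_eq_one (m : ℕ) (d n : Fin (m + 1) → ℝ)
    (hS : IsUnit (sylv m d n)) :
    ∑ k, n k • subCols m (lastRows m (sylv m d n)⁻¹) k = 1 := by
  have h := nonsing_inv_mul _ ((isUnit_iff_isUnit_det _).1 hS)
  generalize (sylv m d n)⁻¹ = B at h ⊢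
  ext r c
  have hrc := congrFun (congrFun h (Fin.natAdd m r)) (Fin.natAdd m c)
  rw [mul_apply, Fin.sum_univ_add] at hrc
  simp only [sylv, submatrix_apply, finSumFinEquiv_symm_apply_castAdd,
    finSumFinEquiv_symm_apply_natAdd, fromBlocks_apply₁₂, fromBlocks_apply₂₂] at hrc
  rw [sum_mul_toeplitz_column] at hrc
  have hone : (1 : Matrix (Fin (m + m)) (Fin (m + m)) ℝ) (Fin.natAdd m r) (Fin.natAdd m c) =
      (1 : Matrix (Fin m) (Fin m) ℝ) r c := by
    simp [one_apply]
  rw [hone] at hrc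
  rw [Matrix.sum_apply]
  exact hrc

/-- The companion matrix of the polynomial with coefficients `d`. -/
def companionMat (m : ℕ) (d : Fin (m + 1) → ℝ) : Matrix (Fin m) (Fin m) ℝ :=
  fun r c => if (c : ℕ) + 1 < m then (if (r : ℕ) = c + 1 then 1 else 0)
    else -d r.castSucc / d (Fin.last m)

theorem subCols_succ (m : ℕ) (d : Fin (m + 1) → ℝ) (hd : d (Fin.last m) ≠ 0)
    (M : Matrix (Fin m) (Fin (m + m)) ℝ) (hM : ∑ k, d k • subCols m M k = 0) (k : Fin m) :
    subCols m M k.succ = subCols m M k.castSucc * companionMat m d := by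
  ext r c
  rw [mul_apply]
  by_cases hc : (c : ℕ) + 1 < m
  · rw [Finset.sum_eq_single ⟨c + 1, hc⟩]
    · simp only [companionMat, hc, subCols, if_true, mul_one]
      congr 2
      simp; omega
    · intro b _ hb
      have : (b : ℕ) ≠ c + 1 := fun e => hb (Fin.ext e)
      simp [companionMat, hc, this]
    · simp
  · have h := congrFun (congrFun hM r) k
    simp only [Matrix.sum_apply, Matrix.smul_apply, subCols, Matrix.zero_apply, smul_eq_mul] at h
    rw [Fin.sum_univ_castSucc] at h
    have hcol : subCols m M k.succ r c = M r ⟨(Fin.last m : ℕ) + k, by simp⟩ := by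
      simp only [subCols]
      congr 2
      simp; omega
    have hsum : ∑ j, subCols m M k.castSucc r j * companionMat m d j c =
        -(∑ i : Fin m, d i.castSucc * M r ⟨(i.castSucc : ℕ) + k, by simp; omega⟩) /
          d (Fin.last m) := by
      rw [← Finset.sum_neg_distrib, Finset.sum_div]
      refine Finset.sum_congr rfl fun j _ => ?_
      simp only [companionMat, hc, subCols, if_false, Fin.val_castSucc, add_comm (k : ℕ)]
      ring
    rw [hcol, hsum, eq_div_iff hd]
    linarith

theorem subCols_eq_mul_pow (m : ℕ) (d : Fin (m + 1) → ℝ) (hd : d (Fin.last m) ≠ 0)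
    (M : Matrix (Fin m) (Fin (m + m)) ℝ) (hM : ∑ k, d k • subCols m M k = 0) (k : Fin (m + 1)) :
    subCols m M k = subCols m M 0 * companionMat m d ^ (k : ℕ) := by
  induction k using Fin.induction with
  | zero => simp
  | succ k ih => rw [subCols_succ m d hd M hM, ih, mul_assoc, Fin.val_succ, pow_succ]; rfl

theorem inv_commute (m : ℕ) (hm : 1 ≤ m) (d n : Fin (m + 1) → ℝ) (hd : ∀ k, d k ≠ 0) (hn : ∀ k, n k ≠ 0)
    (hS : IsUnit (sylv m d n)) (hD : IsUnit (dMat m d)) :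
    ∀ i j : Fin (m + 1), i < j →
      IsUnit (subCols m (lastRows m (sylv m d n)⁻¹) i) ∧
        (subCols m (lastRows m (sylv m d n)⁻¹) i)⁻¹ * subCols m (lastRows m (sylv m d n)⁻¹) j =
          subCols m (lastRows m (sylv m d n)⁻¹) j * (subCols m (lastRows m (sylv m d n)⁻¹) i)⁻¹ := by
  set M := lastRows m (sylv m d n)⁻¹
  set C := companionMat m d
  have hM0 : ∑ k, d k • subCols m M k = 0 := sum_smul_subCols_lastRows_eq_zero m d n hS
  have hM1 : ∑ k, n k • subCols m M k = 1 := sum_smul_subCols_lastRows_eq_one m d n hS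
  have hpow := subCols_eq_mul_pow m d (hd _) M hM0
  have hinv : subCols m M 0 * ∑ k : Fin (m + 1), n k • C ^ (k : ℕ) = 1 := by
    rw [← hM1, Finset.mul_sum]
    exact Finset.sum_congr rfl fun k _ => by rw [mul_smul_comm, ← hpow k]
  have hinv' := mul_eq_one_comm.1 hinv
  have hroot : ∑ k : Fin (m + 1), d k • C ^ (k : ℕ) = 0 := by
    have h : subCols m M 0 * ∑ k : Fin (m + 1), d k • C ^ (k : ℕ) = 0 := by
      rw [← hM0, Finset.mul_sum]
      exact Finset.sum_congr rfl fun k _ => by rw [mul_smul_comm, ← hpow k]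
    simpa [← mul_assoc, hinv'] using congrArg ((∑ k : Fin (m + 1), n k • C ^ (k : ℕ)) * ·) h
  have hC : IsUnit C := by
    refine IsUnit.of_mul_eq_one (-(d 0)⁻¹ • ∑ k : Fin m, d k.succ • C ^ (k : ℕ)) ?_
    rw [Fin.sum_univ_succ] at hroot
    have h : C * ∑ k : Fin m, d k.succ • C ^ (k : ℕ) = -(d 0 • 1) := by
      rw [eq_neg_iff_add_eq_zero, add_comm, Finset.mul_sum, ← hroot]
      simp [pow_succ']
    rw [mul_smul_comm, h, smul_neg, neg_smul, neg_neg, smul_smul, inv_mul_cancel₀ (hd 0), one_smul]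
  have hunit0 : IsUnit (subCols m M 0) := IsUnit.of_mul_eq_one _ hinv
  have hcomm0 : Commute (subCols m M 0) C := by
    have h : Commute (∑ k : Fin (m + 1), n k • C ^ (k : ℕ)) C :=
      Commute.sum_left _ _ _ fun k _ => ((Commute.refl C).pow_left k).smul_left _
    calc subCols m M 0 * C
        = subCols m M 0 * (C * ∑ k : Fin (m + 1), n k • C ^ (k : ℕ)) * subCols m M 0 := by
          rw [mul_assoc, mul_assoc, hinv', mul_one]
      _ = C * subCols m M 0 := by rw [← h.eq, ← mul_assoc, hinv, one_mul]
  intro i j _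
  have hi : IsUnit (subCols m M i) := by
    rw [hpow i]
    exact hunit0.mul (hC.pow _)
  have hij : Commute (subCols m M i) (subCols m M j) := by
    rw [hpow i, hpow j]
    exact ((Commute.refl _).mul_right (hcomm0.pow_right _)).mul_left
      ((hcomm0.symm.pow_left _).mul_right ((Commute.refl C).pow_pow _ _))
  refine ⟨hi, ?_⟩
  have hdet := (isUnit_iff_isUnit_det _).1 hi
  calc (subCols m M i)⁻¹ * subCols m M j
      = (subCols m M i)⁻¹ * (subCols m M j * subCols m M i) * (subCols m M i)⁻¹ := by
        rw [← mul_assoc, mul_nonsing_inv_cancel_right _ _ hdet]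
    _ = subCols m M j * (subCols m M i)⁻¹ := by
        rw [← hij.eq, nonsing_inv_mul_cancel_left _ _ hdet]
end
end

section
/- For every i with 1 ≤ i ≤ m+1, the matrix A_{m−i+2} is invertible and T_i = (A_{m−i+2})⁻¹ · A_B; equivalently, A_i⁻¹ · A_B = T_{m−i+2}. -/
open Matrix

noncomputable section

/-- The entry in row `r` and column `c` of the infinite banded Toeplitz matrix with coefficients
`a` on the diagonals `0, …, m` below the main one. -/
def toeplitzBand (m : ℕ) (a : Fin (m + 1) → ℝ) (r c : ℕ) : ℝ :=
  if h : c ≤ r ∧ r ≤ c + m then a ⟨r - c, by omega⟩ else 0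

theorem lowT_apply_eq_toeplitzBand (m : ℕ) (a : Fin (m + 1) → ℝ) (i j : Fin m) :
    lowT m a i j = toeplitzBand m a i j := by
  have := i.2
  have h : (j : ℕ) ≤ i ↔ (j : ℕ) ≤ i ∧ (i : ℕ) ≤ j + m := by omega
  simp only [lowT, toeplitzBand, ← h]

theorem upT_apply_eq_toeplitzBand (m : ℕ) (a : Fin (m + 1) → ℝ) (i j : Fin m) :
    upT m a i j = toeplitzBand m a (m + i) j := by
  have := j.2
  have h : (i : ℕ) ≤ j ↔ (j : ℕ) ≤ m + i ∧ m + (i : ℕ) ≤ j + m := by omega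
  simp only [upT, toeplitzBand, ← h]

theorem toeplitzBand_add_add (m : ℕ) (a : Fin (m + 1) → ℝ) (k r c : ℕ) :
    toeplitzBand m a (k + r) (k + c) = toeplitzBand m a r c := by
  have h : (k + c ≤ k + r ∧ k + r ≤ k + c + m) ↔ (c ≤ r ∧ r ≤ c + m) := by omega
  simp only [toeplitzBand, h, Nat.add_sub_add_left]

theorem toeplitzBand_eq_zero (m : ℕ) (a : Fin (m + 1) → ℝ) {r c : ℕ}
    (h : ¬(c ≤ r ∧ r ≤ c + m)) : toeplitzBand m a r c = 0 :=
  dif_neg h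

theorem dMat_apply_castAdd (m : ℕ) (d : Fin (m + 1) → ℝ) (r : Fin (m + m)) (j : Fin m) :
    dMat m d r (Fin.castAdd m j) = toeplitzBand m d r j := by
  induction r using Fin.addCases <;>
    simp [-Fin.natAdd_eq_addNat, dMat, lowT_apply_eq_toeplitzBand, upT_apply_eq_toeplitzBand]

theorem kMat_apply_eq_toeplitzBand (m : ℕ) (a : Fin (m + 1) → ℝ) (r : Fin (m + m + m))
    (c : Fin (m + m)) : kMat m a r c = toeplitzBand m a r c := by
  induction r using Fin.addCases with
  | left r =>
    induction r using Fin.addCases with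
    | left r =>
      induction c using Fin.addCases with
      | left c => simp [-Fin.natAdd_eq_addNat, kMat, lowT_apply_eq_toeplitzBand]
      | right c =>
        rw [toeplitzBand_eq_zero _ _ (by simp; omega)]
        simp [-Fin.natAdd_eq_addNat, kMat]
    | right r =>
      induction c using Fin.addCases with
      | left c => simp [-Fin.natAdd_eq_addNat, kMat, upT_apply_eq_toeplitzBand]
      | right c => simp [-Fin.natAdd_eq_addNat, kMat, lowT_apply_eq_toeplitzBand, toeplitzBand_add_add]
  | right r =>
    induction c using Fin.addCases with
    | left c =>
      rw [toeplitzBand_eq_zero _ _ (by simp; omega)]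
      simp [-Fin.natAdd_eq_addNat, kMat]
    | right c =>
      simp [-Fin.natAdd_eq_addNat, kMat, upT_apply_eq_toeplitzBand, add_assoc, toeplitzBand_add_add]

theorem isUnit_det_lowT (m : ℕ) {a : Fin (m + 1) → ℝ} (h : a 0 ≠ 0) :
    IsUnit (lowT m a).det := by
  rw [det_of_isLowerTriangular]
  · simp [lowT, h]
  · intro i j hij
    exact dif_neg (by simpa using hij)

theorem isUnit_det_upT (m : ℕ) {a : Fin (m + 1) → ℝ} (h : a (Fin.last m) ≠ 0) :
    IsUnit (upT m a).det := by
  have h' : a ⟨m, m.lt_succ_self⟩ ≠ 0 := h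
  rw [det_of_isUpperTriangular]
  · simp [upT, Finset.prod_eq_zero_iff, h']
  · intro i j hij
    exact dif_neg (by simpa using hij)

theorem kerT_mul_kMat (m : ℕ) {d : Fin (m + 1) → ℝ} (h0 : d 0 ≠ 0) (hm : d (Fin.last m) ≠ 0) :
    kerT m d * kMat m d = 0 := by
  rw [kerT, kMat, submatrix_mul_equiv, fromCols_mul_fromRows, fromCols_mul_fromRows,
    mul_fromCols, mul_fromCols, mul_fromCols]
  simp only [Matrix.neg_mul, Matrix.mul_assoc, nonsing_inv_mul _ (isUnit_det_lowT m h0),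
    nonsing_inv_mul _ (isUnit_det_upT m hm), Matrix.mul_one, Matrix.one_mul, Matrix.mul_zero]
  ext r c
  induction c using Fin.addCases <;> simp [-Fin.natAdd_eq_addNat]

theorem tSub_mul_dMat_castAdd (m : ℕ) {d : Fin (m + 1) → ℝ} (h0 : d 0 ≠ 0)
    (hm : d (Fin.last m) ≠ 0) (i : Fin (m + 1)) (r j : Fin m) :
    (tSub m d i * dMat m d) r (Fin.castAdd m j) = 0 := by
  have hi := i.2
  have hj := j.2
  have hK := congrFun₂ (kerT_mul_kMat m h0 hm) r ⟨i + j, by omega⟩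
  rw [mul_apply, Matrix.zero_apply] at hK
  rw [mul_apply, ← hK]
  refine Fintype.sum_of_injective
    (fun c : Fin (m + m) => (⟨i + c, by omega⟩ : Fin (m + m + m))) ?_ _ _ ?_ ?_
  · intro a b hab
    simpa [Fin.ext_iff] using hab
  · intro s hs
    rw [kMat_apply_eq_toeplitzBand, toeplitzBand_eq_zero, mul_zero]
    rintro ⟨h₁, h₂⟩
    simp only at h₁ h₂
    exact hs ⟨⟨s - i, by omega⟩, Fin.ext (by simp; omega)⟩
  · intro c
    rw [dMat_apply_castAdd, kMat_apply_eq_toeplitzBand]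
    simp only [toeplitzBand_add_add]
    rfl

/-- The last `m` columns of `tSub m d i * dMat m d`. -/
def tSubMulRight (m : ℕ) (d : Fin (m + 1) → ℝ) (i : Fin (m + 1)) : Matrix (Fin m) (Fin m) ℝ :=
  (tSub m d i * dMat m d).submatrix id (Fin.natAdd m)

theorem tSub_eq_tSubMulRight_mul (m : ℕ) {d : Fin (m + 1) → ℝ} (h0 : d 0 ≠ 0)
    (hm : d (Fin.last m) ≠ 0) (hD : IsUnit (dMat m d)) (i : Fin (m + 1)) :
    tSub m d i = tSubMulRight m d i * lastRows m (dMat m d)⁻¹ := by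
  conv_lhs => rw [← mul_nonsing_inv_cancel_right (dMat m d) (tSub m d i)
    ((isUnit_iff_isUnit_det _).mp hD)]
  ext r c
  rw [mul_apply, Fin.sum_univ_add]
  simp only [tSub_mul_dMat_castAdd m h0 hm, zero_mul, Finset.sum_const_zero, zero_add]
  rfl

theorem subCols_tSub_revIdx (m : ℕ) (d : Fin (m + 1) → ℝ) (i : Fin (m + 1)) :
    subCols m (tSub m d i) (revIdx m i) = 1 := by
  ext r c
  have hi := i.2
  have hidx : (⟨i + (m - i + c), by omega⟩ : Fin (m + m + m)) =
      Fin.castAdd m (Fin.natAdd m c) := Fin.ext (by simp; omega)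
  simp only [subCols, tSub, revIdx, hidx]
  simp [-Fin.natAdd_eq_addNat, kerT]

theorem subCols_mul (m : ℕ) (X : Matrix (Fin m) (Fin m) ℝ) (M : Matrix (Fin m) (Fin (m + m)) ℝ)
    (i : Fin (m + 1)) : subCols m (X * M) i = X * subCols m M i :=
  rfl

theorem revIdx_revIdx (m : ℕ) (i : Fin (m + 1)) : revIdx m (revIdx m i) = i :=
  Fin.ext (by simp [revIdx]; omega)

theorem tSub_eq_inv_aSub_mul (m : ℕ) (hm : 1 ≤ m) (d n : Fin (m + 1) → ℝ) (hd : ∀ k, d k ≠ 0) (hn : ∀ k, n k ≠ 0)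
    (hD : IsUnit (dMat m d)) :
    ∀ i : Fin (m + 1),
      IsUnit (subCols m (lastRows m (dMat m d)⁻¹) (revIdx m i)) ∧
        tSub m d i = (subCols m (lastRows m (dMat m d)⁻¹) (revIdx m i))⁻¹ * (lastRows m (dMat m d)⁻¹) ∧
          (subCols m (lastRows m (dMat m d)⁻¹) i)⁻¹ * (lastRows m (dMat m d)⁻¹) = tSub m d (revIdx m i) := by
  have hmul (i : Fin (m + 1)) :
      tSubMulRight m d i * subCols m (lastRows m (dMat m d)⁻¹) (revIdx m i) = 1 := by
    rw [← subCols_mul, ← tSub_eq_tSubMulRight_mul m (hd _) (hd _) hD, subCols_tSub_revIdx]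
  have htSub (i : Fin (m + 1)) : tSub m d i =
      (subCols m (lastRows m (dMat m d)⁻¹) (revIdx m i))⁻¹ * lastRows m (dMat m d)⁻¹ := by
    rw [inv_eq_left_inv (hmul i)]
    exact tSub_eq_tSubMulRight_mul m (hd _) (hd _) hD i
  refine fun i => ⟨IsUnit.of_mul_eq_one_right _ (hmul i), htSub i, ?_⟩
  rw [htSub (revIdx m i), revIdx_revIdx]
end
end
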